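/- Under the same setup, the fourth cumulant of h_{l;2} := ∫_{S²} H₂(f_l(x))dx equals cum₄(h_{l;2}) = 48 (4π)⁴/(2l+1)³, hence cum₄(h_{l;2})/Var(h_{l;2})² = 12/(2l+1) → 0 as l → ∞. -/

import Mathlib

open MeasureTheory ProbabilityTheory Polynomial Real Filter

noncomputable def legendreP (l : ℕ) : Polynomial ℝ :=
  Polynomial.C (1 / (2 ^ l * (Nat.factorial l) : ℝ)) *
    (⇑Polynomial.derivative)^[l] ((Polynomial.X ^ 2 - 1) ^ l)

abbrev E3 := EuclideanSpace ℝ (Fin 3)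
abbrev S2 := Metric.sphere (0 : E3) 1

theorem legendreP_natDegree_le (l : ℕ) : (legendreP l).natDegree ≤ l := by
  unfold legendreP
  refine (natDegree_C_mul_le _ _).trans ((natDegree_iterate_derivative _ _).trans ?_)
  have : ((X ^ 2 - 1 : ℝ[X]) ^ l).natDegree ≤ l * 2 :=
    natDegree_pow_le_of_le l (by compute_degree)
  omega

theorem legendreP_coeff_ne_zero (l : ℕ) : (legendreP l).coeff l ≠ 0 := by
  have hm : (X ^ 2 - 1 : ℝ[X]).Monic := by monicity!
  have hd : (X ^ 2 - 1 : ℝ[X]).natDegree = 2 := by compute_degree!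
  have hc : ((X ^ 2 - 1 : ℝ[X]) ^ l).coeff (l + l) = 1 := by
    have := (hm.pow l).coeff_natDegree
    rwa [hm.natDegree_pow, hd, mul_two] at this
  unfold legendreP
  rw [coeff_C_mul, coeff_iterate_derivative, hc]
  have : (l + l).descFactorial l ≠ 0 := by
    rw [Ne, Nat.descFactorial_eq_zero_iff_lt]; omega
  have : ((l + l).descFactorial l : ℝ) ≠ 0 := by exact_mod_cast this
  simp only [nsmul_eq_mul, mul_one]
  positivity

theorem legendreP_eval_one (l : ℕ) : (legendreP l).eval 1 = 1 := by
  have h := aeval_iterate_derivative_self (A := ℝ) ((X ^ 2 - 1 : ℝ[X]) ^ l) l (1 : ℝ)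
    (p' := (X + 1) ^ l) (by rw [← mul_pow]; simp; congr 1; ring)
  rw [coe_aeval_eq_eval] at h
  unfold legendreP
  rw [eval_mul, eval_C, h]
  have : ((Nat.factorial l : ℕ) : ℝ) ≠ 0 := by positivity
  simp
  field_simp
  norm_num

theorem legendreP_eval_neg_one_sq (l : ℕ) : (legendreP l).eval (-1) ^ 2 = 1 := by
  have h := aeval_iterate_derivative_self (A := ℝ) ((X ^ 2 - 1 : ℝ[X]) ^ l) l (-1 : ℝ)
    (p' := (X - 1) ^ l) (by rw [← mul_pow]; simp; congr 1; ring)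
  rw [coe_aeval_eq_eval] at h
  unfold legendreP
  rw [eval_mul, eval_C, h]
  have : ((Nat.factorial l : ℕ) : ℝ) ≠ 0 := by positivity
  simp
  field_simp
  rw [show (-1 - 1 : ℝ) = -1 * 2 by norm_num, mul_pow]
  rcases neg_one_pow_eq_or ℝ l with h | h <;> simp [h]

/-- Integration by parts for a functional that kills derivatives of multiples of `X ^ 2 - 1`. -/
theorem annihilates_derivative_iterate {Λ : ℝ[X] →ₗ[ℝ] ℝ}
    (hΛ : ∀ g, Λ (derivative ((X ^ 2 - 1) * g)) = 0) {l : ℕ} :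
    ∀ k ≤ l, ∀ q : ℝ[X],
      Λ ((derivative^[k] ((X ^ 2 - 1) ^ l)) * q) =
        (-1) ^ k * Λ ((X ^ 2 - 1) ^ l * derivative^[k] q) := by
  intro k
  induction k with
  | zero => simp
  | succ k ih =>
    intro hk q
    obtain ⟨g, hg⟩ : (X ^ 2 - 1 : ℝ[X]) ∣ derivative^[k] ((X ^ 2 - 1) ^ l) :=
      (dvd_pow_self _ (by omega)).trans (pow_sub_dvd_iterate_derivative_pow _ l k)
    have h0 := hΛ (g * q)
    rw [← mul_assoc, ← hg, derivative_mul, map_add] at h0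
    have h1 := ih (by omega) (derivative q)
    rw [Function.iterate_succ_apply', Function.iterate_succ_apply]
    rw [pow_succ (-1 : ℝ)]
    linarith

theorem legendreP_orthogonal {Λ : ℝ[X] →ₗ[ℝ] ℝ}
    (hΛ : ∀ g, Λ (derivative ((X ^ 2 - 1) * g)) = 0) {l : ℕ} {q : ℝ[X]} (hq : q.degree < l) :
    Λ (legendreP l * q) = 0 := by
  unfold legendreP
  rw [mul_assoc, ← smul_eq_C_mul, map_smul, annihilates_derivative_iterate hΛ l le_rfl,
    iterate_derivative_eq_zero_of_degree_lt hq]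
  simp

theorem legendreP_norm_sq {Λ : ℝ[X] →ₗ[ℝ] ℝ}
    (hΛ : ∀ g, Λ (derivative ((X ^ 2 - 1) * g)) = 0) (l : ℕ) :
    (2 * (l : ℝ) + 1) * Λ (legendreP l * legendreP l) = Λ 1 := by
  set P := legendreP l with hP
  have hdvd : (X ^ 2 - 1 : ℝ[X]) ∣ X * P ^ 2 - X := by
    have e : (X ^ 2 - 1 : ℝ[X]) = (X - C 1) * (X - C (-1)) := by simp; ring
    rw [e]
    refine IsCoprime.mul_dvd (isCoprime_X_sub_C_of_isUnit_sub (by norm_num)) ?_ ?_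
    · rw [dvd_iff_isRoot]; simp [hP, legendreP_eval_one]
    · rw [dvd_iff_isRoot]; simp [hP, legendreP_eval_neg_one_sq]
  obtain ⟨g, hg⟩ := hdvd
  have h1 := hΛ g
  rw [← hg] at h1
  have h2 : Λ (P * (X * derivative P - C (l : ℝ) * P)) = 0 := by
    refine legendreP_orthogonal hΛ ?_
    rw [degree_lt_iff_coeff_zero]
    intro m hm
    rcases m with _ | m
    · have : l = 0 := by omega
      subst this; simp
    · rw [coeff_sub, coeff_X_mul, coeff_derivative, coeff_C_mul]
      rcases hm.eq_or_lt with h | h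
      · rw [h]; push_cast; ring
      · rw [coeff_eq_zero_of_natDegree_lt (lt_of_le_of_lt (legendreP_natDegree_le l) h)]; simp
  have e1 : derivative (X * P ^ 2 - X) = P * P + (2 : ℝ) • (P * (X * derivative P)) - 1 := by
    rw [derivative_sub, derivative_mul, derivative_X, derivative_pow, smul_eq_C_mul]
    have h2 : (C 2 : ℝ[X]) = 2 := rfl
    norm_num [h2]
    ring
  rw [e1, map_sub, map_add, map_smul] at h1
  have e2 : P * (X * derivative P - C (l : ℝ) * P) = P * (X * derivative P) - (l : ℝ) • (P * P) := by
    rw [smul_eq_C_mul]; ring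
  rw [e2, map_sub, map_smul] at h2
  simp only [smul_eq_mul] at h1 h2
  linarith

/-- Invariance of the integral of continuous functions under linear isometries of `ℝ³`. -/
def RotationInvariant (μ : Measure S2) : Prop :=
  ∀ (R : E3 ≃ₗᵢ[ℝ] E3) (F : E3 → ℝ), Continuous F → ∫ y : S2, F (R y) ∂μ = ∫ y : S2, F y ∂μ

theorem rotationInvariant_of_map_eq {μ : Measure S2}
    (hmem : ∀ (R : E3 ≃ₗᵢ[ℝ] E3) (y : S2), R y ∈ Metric.sphere (0 : E3) 1)
    (hrot : ∀ R : E3 ≃ₗᵢ[ℝ] E3, Measure.map (fun y : S2 => (⟨R y, hmem R y⟩ : S2)) μ = μ) :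
    RotationInvariant μ := by
  intro R F hF
  have hR : Continuous (fun y : S2 => (⟨R y, hmem R y⟩ : S2)) :=
    Continuous.subtype_mk (R.continuous.comp continuous_subtype_val) _
  conv_rhs => rw [← hrot R]
  rw [integral_map hR.aemeasurable (by fun_prop)]

theorem integrable_of_continuous {μ : Measure S2} [IsFiniteMeasure μ] {F : S2 → ℝ}
    (hF : Continuous F) : Integrable F μ := by
  rw [← integrableOn_univ]
  exact hF.continuousOn.integrableOn_compact isCompact_univ

theorem RotationInvariant.integral_orthonormal {μ : Measure S2} (hμ : RotationInvariant μ)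
    {v : Fin 3 → E3} (hv : Orthonormal ℝ v) {F : ℝ → ℝ → ℝ → ℝ}
    (hF : Continuous fun p : ℝ × ℝ × ℝ => F p.1 p.2.1 p.2.2) :
    ∫ y : S2, F (inner ℝ (v 0) (y : E3)) (inner ℝ (v 1) (y : E3)) (inner ℝ (v 2) (y : E3)) ∂μ =
      ∫ y : S2, F ((y : E3) 0) ((y : E3) 1) ((y : E3) 2) ∂μ := by
  obtain ⟨b, hb⟩ := Orthonormal.exists_orthonormalBasis_extension_of_card_eq
    (s := Set.univ) (v := v) (by simp) (hv.comp _ Subtype.val_injective)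
  have h := hμ b.repr (fun y => F (y 0) (y 1) (y 2))
    (hF.comp (f := fun y : E3 => (y 0, y 1, y 2)) (by fun_prop))
  simpa only [b.repr_apply_apply, hb _ (Set.mem_univ _)] using h

theorem orthonormal_rotate01 (θ : ℝ) :
    Orthonormal ℝ (![!₂[cos θ, -sin θ, 0], !₂[sin θ, cos θ, 0], !₂[0, 0, 1]] : Fin 3 → E3) := by
  rw [orthonormal_iff_ite]
  intro i j
  fin_cases i <;> fin_cases j <;>
    rw [PiLp.inner_apply, Fin.sum_univ_three] <;> simp <;> nlinarith [sin_sq_add_cos_sq θ]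

theorem orthonormal_rotate12 (θ : ℝ) :
    Orthonormal ℝ (![!₂[1, 0, 0], !₂[0, cos θ, -sin θ], !₂[0, sin θ, cos θ]] : Fin 3 → E3) := by
  rw [orthonormal_iff_ite]
  intro i j
  fin_cases i <;> fin_cases j <;>
    rw [PiLp.inner_apply, Fin.sum_univ_three] <;> simp <;> nlinarith [sin_sq_add_cos_sq θ]

theorem integral_deriv_eq_zero_of_const {μ : Measure S2} [IsFiniteMeasure μ] {G G' : ℝ → S2 → ℝ}
    (hG : ∀ θ, Continuous (G θ)) (hG' : Continuous fun p : ℝ × S2 => G' p.1 p.2)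
    (hd : ∀ θ y, HasDerivAt (fun τ => G τ y) (G' θ y) θ) {c : ℝ}
    (hc : ∀ θ, ∫ y, G θ y ∂μ = c) : ∫ y, G' 0 y ∂μ = 0 := by
  obtain ⟨C, hC⟩ := ((isCompact_Icc (a := (-1 : ℝ)) (b := 1)).prod
    (isCompact_univ (X := S2))).exists_bound_of_continuousOn hG'.continuousOn
  have h := (hasDerivAt_integral_of_dominated_loc_of_deriv_le (μ := μ) (F := G) (F' := G')
    (x₀ := 0) (bound := fun _ => C) (Icc_mem_nhds (by norm_num : (-1 : ℝ) < 0) one_pos)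
    (Eventually.of_forall fun θ => (hG θ).aestronglyMeasurable) (integrable_of_continuous (hG 0))
    (hG'.comp (Continuous.prodMk_right 0)).aestronglyMeasurable
    (Eventually.of_forall fun y θ hθ => hC (θ, y) ⟨hθ, Set.mem_univ _⟩)
    (integrable_const _) (Eventually.of_forall fun y θ _ => hd θ y)).2
  simp_rw [hc] at h
  exact h.unique (hasDerivAt_const _ _)

theorem sphere_coord_sq (y : S2) : (y : E3) 0 ^ 2 + (y : E3) 1 ^ 2 + (y : E3) 2 ^ 2 = 1 := by
  have h : ‖(y : E3)‖ = 1 := mem_sphere_zero_iff_norm.mp y.2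
  have := EuclideanSpace.real_norm_sq_eq (y : E3)
  rw [h, Fin.sum_univ_three] at this
  linarith

/-- Integration of zonal polynomials as a linear functional. -/
noncomputable def zonal (μ : Measure S2) [IsFiniteMeasure μ] : ℝ[X] →ₗ[ℝ] ℝ where
  toFun p := ∫ y : S2, p.eval ((y : E3) 0) ∂μ
  map_add' p q := by
    simp only [eval_add]
    exact integral_add (integrable_of_continuous (by fun_prop))
      (integrable_of_continuous (by fun_prop))
  map_smul' c p := by
    simp only [eval_smul, smul_eq_mul, RingHom.id_apply]
    exact integral_const_mul _ _

theorem zonal_apply (μ : Measure S2) [IsFiniteMeasure μ] (p : ℝ[X]) :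
    zonal μ p = ∫ y : S2, p.eval ((y : E3) 0) ∂μ := rfl

section SphereIntegrals

variable {μ : Measure S2}

theorem RotationInvariant.exists_integral_frame (hμ : RotationInvariant μ) (x z : S2) :
    ∃ s : ℝ, s ^ 2 = 1 - inner ℝ (x : E3) (z : E3) ^ 2 ∧
      ∀ F : ℝ → ℝ → ℝ, (Continuous fun p : ℝ × ℝ => F p.1 p.2) →
        ∫ y : S2, F (inner ℝ (x : E3) (y : E3)) (inner ℝ (z : E3) (y : E3)) ∂μ =
        ∫ y : S2, F ((y : E3) 0) (inner ℝ (x : E3) (z : E3) * (y : E3) 0 + s * (y : E3) 1) ∂μ := by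
  have hx : ‖(x : E3)‖ = 1 := mem_sphere_zero_iff_norm.mp x.2
  have hz : ‖(z : E3)‖ = 1 := mem_sphere_zero_iff_norm.mp z.2
  have hcard : Module.finrank ℝ E3 = Fintype.card (Fin 3) := by simp
  set w : Fin 3 → E3 := ![(x : E3), (z : E3), 0] with hw
  set b := InnerProductSpace.gramSchmidtOrthonormalBasis hcard w with hb
  have h0 : b 0 = (x : E3) := by
    have hg : InnerProductSpace.gramSchmidtNormed ℝ w 0 = (x : E3) := by
      rw [InnerProductSpace.gramSchmidtNormed,
        show InnerProductSpace.gramSchmidt ℝ w 0 = (x : E3) from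
          InnerProductSpace.gramSchmidt_bot ℝ w]
      simp [hx]
    rw [hb, InnerProductSpace.gramSchmidtOrthonormalBasis_apply, hg]
    rw [hg]
    intro h
    simp [h] at hx
  have h2 : inner ℝ (b 2) (z : E3) = 0 :=
    InnerProductSpace.gramSchmidtOrthonormalBasis_inv_triangular hcard w
      (show (1 : Fin 3) < 2 by decide)
  have hzs : (z : E3) = inner ℝ (x : E3) (z : E3) • b 0 + inner ℝ (b 1) (z : E3) • b 1 := by
    conv_lhs => rw [← b.sum_repr' (z : E3)]
    rw [Fin.sum_univ_three, h2, h0]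
    simp
  refine ⟨inner ℝ (b 1) (z : E3), ?_, fun F hF => ?_⟩
  · have := b.sum_sq_norm_inner_right (z : E3)
    rw [Fin.sum_univ_three, h2, h0, hz] at this
    simp at this
    linarith
  · have h := hμ.integral_orthonormal b.orthonormal
      (F := fun u v _ => F u (inner ℝ (x : E3) (z : E3) * u + inner ℝ (b 1) (z : E3) * v))
      (hF.comp (f := fun p : ℝ × ℝ × ℝ => (p.1, inner ℝ (x : E3) (z : E3) * p.1 +
        inner ℝ (b 1) (z : E3) * p.2.1)) (by fun_prop))
    rw [← h]
    refine integral_congr_ae (Eventually.of_forall fun y => ?_)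
    have : inner ℝ (z : E3) (y : E3) = inner ℝ (x : E3) (z : E3) * inner ℝ (b 0) (y : E3) +
        inner ℝ (b 1) (z : E3) * inner ℝ (b 1) (y : E3) := by
      conv_lhs => rw [hzs]
      rw [inner_add_left, real_inner_smul_left, real_inner_smul_left]
    simp only [this, h0]

variable [IsFiniteMeasure μ]

theorem RotationInvariant.integral_rotate12 (hμ : RotationInvariant μ) (g : ℝ[X]) (n : ℕ) :
    ∫ y : S2, g.eval ((y : E3) 0) * ((y : E3) 1 ^ (n + 1) -
      n * (y : E3) 1 ^ (n - 1) * (y : E3) 2 ^ 2) ∂μ = 0 := by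
  have h := integral_deriv_eq_zero_of_const (μ := μ)
    (G := fun θ y => g.eval ((y : E3) 0) * ((cos θ * (y : E3) 1 - sin θ * (y : E3) 2) ^ n *
      (sin θ * (y : E3) 1 + cos θ * (y : E3) 2)))
    (G' := fun θ y => g.eval ((y : E3) 0) *
      ((n * (cos θ * (y : E3) 1 - sin θ * (y : E3) 2) ^ (n - 1) *
          (-sin θ * (y : E3) 1 - cos θ * (y : E3) 2)) * (sin θ * (y : E3) 1 + cos θ * (y : E3) 2) +
        (cos θ * (y : E3) 1 - sin θ * (y : E3) 2) ^ n *
          (cos θ * (y : E3) 1 + -sin θ * (y : E3) 2)))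
    (c := ∫ y : S2, g.eval ((y : E3) 0) * ((y : E3) 1 ^ n * (y : E3) 2) ∂μ)
    (fun θ => by fun_prop) (by fun_prop)
    (fun θ y => ((((((hasDerivAt_cos θ).mul_const _).sub ((hasDerivAt_sin θ).mul_const _)).pow n).mul
      (((hasDerivAt_sin θ).mul_const _).add ((hasDerivAt_cos θ).mul_const _))).const_mul _))
    (fun θ => by
      have := hμ.integral_orthonormal (orthonormal_rotate12 θ)
        (F := fun a b c => g.eval a * (b ^ n * c)) (by fun_prop)
      rw [← this]
      refine integral_congr_ae (Eventually.of_forall fun y => ?_)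
      simp [PiLp.inner_apply, Fin.sum_univ_three]
      left; ring)
  rw [← h]
  refine integral_congr_ae (Eventually.of_forall fun y => ?_)
  simp
  left; ring

theorem RotationInvariant.integral_rotate01 (hμ : RotationInvariant μ) (g : ℝ[X]) :
    ∫ y : S2, (g.eval ((y : E3) 0) * (y : E3) 0 -
      (derivative g).eval ((y : E3) 0) * (y : E3) 1 ^ 2) ∂μ = 0 := by
  have h := integral_deriv_eq_zero_of_const (μ := μ)
    (G := fun θ y => g.eval (cos θ * (y : E3) 0 - sin θ * (y : E3) 1) *
      (sin θ * (y : E3) 0 + cos θ * (y : E3) 1))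
    (G' := fun θ y => ((derivative g).eval (cos θ * (y : E3) 0 - sin θ * (y : E3) 1) *
          (-sin θ * (y : E3) 0 - cos θ * (y : E3) 1)) * (sin θ * (y : E3) 0 + cos θ * (y : E3) 1) +
        g.eval (cos θ * (y : E3) 0 - sin θ * (y : E3) 1) *
          (cos θ * (y : E3) 0 + -sin θ * (y : E3) 1))
    (c := ∫ y : S2, g.eval ((y : E3) 0) * ((y : E3) 1) ∂μ)
    (fun θ => by fun_prop) (by fun_prop)
    (fun θ y => (HasDerivAt.comp θ (g.hasDerivAt _)
        (((hasDerivAt_cos θ).mul_const _).sub ((hasDerivAt_sin θ).mul_const _))).mul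
      (((hasDerivAt_sin θ).mul_const _).add ((hasDerivAt_cos θ).mul_const _)))
    (fun θ => by
      have := hμ.integral_orthonormal (orthonormal_rotate01 θ)
        (F := fun a b c => g.eval a * b) (by fun_prop)
      rw [← this]
      refine integral_congr_ae (Eventually.of_forall fun y => ?_)
      simp [PiLp.inner_apply, Fin.sum_univ_three]
      ring_nf)
  rw [← h]
  refine integral_congr_ae (Eventually.of_forall fun y => ?_)
  simp
  ring

theorem RotationInvariant.integral_mul_pow_succ_succ (hμ : RotationInvariant μ) (g : ℝ[X]) (n : ℕ) :
    ∫ y : S2, g.eval ((y : E3) 0) * (y : E3) 1 ^ (n + 2) ∂μ =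
      ((n : ℝ) + 1) / (n + 2) *
        ∫ y : S2, (g * (1 - X ^ 2)).eval ((y : E3) 0) * (y : E3) 1 ^ n ∂μ := by
  have h := hμ.integral_rotate12 g (n + 1)
  have e : ∀ y : S2, g.eval ((y : E3) 0) * ((y : E3) 1 ^ (n + 1 + 1) -
      ((n + 1 : ℕ) : ℝ) * (y : E3) 1 ^ (n + 1 - 1) * (y : E3) 2 ^ 2) =
      (n + 2) * (g.eval ((y : E3) 0) * (y : E3) 1 ^ (n + 2)) -
      (n + 1) * ((g * (1 - X ^ 2)).eval ((y : E3) 0) * (y : E3) 1 ^ n) := by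
    intro y
    have h2 : (y : E3) 2 ^ 2 = 1 - (y : E3) 0 ^ 2 - (y : E3) 1 ^ 2 := by
      linarith [sphere_coord_sq y]
    rw [h2]
    simp
    ring
  simp_rw [e] at h
  rw [integral_sub (integrable_of_continuous (by fun_prop)) (integrable_of_continuous (by fun_prop)),
    integral_const_mul, integral_const_mul] at h
  field_simp
  linarith

theorem RotationInvariant.integral_mul_coord_one (hμ : RotationInvariant μ) (g : ℝ[X]) :
    ∫ y : S2, g.eval ((y : E3) 0) * (y : E3) 1 ∂μ = 0 := by
  simpa using hμ.integral_rotate12 g 0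

/-- The average of the `n`-th power of the second coordinate over circles of constant first
coordinate, as a polynomial in the first coordinate. -/
noncomputable def transverse : ℕ → ℝ[X]
  | 0 => 1
  | 1 => 0
  | n + 2 => C (((n : ℝ) + 1) / (n + 2)) * ((1 - X ^ 2) * transverse n)

theorem natDegree_transverse_le : ∀ n, (transverse n).natDegree ≤ n
  | 0 => by simp [transverse]
  | 1 => by simp [transverse]
  | n + 2 => by
    rw [transverse]
    refine (natDegree_C_mul_le _ _).trans (natDegree_mul_le.trans ?_)
    have h : (1 - X ^ 2 : ℝ[X]).natDegree ≤ 2 := by compute_degree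
    have := natDegree_transverse_le n
    omega

theorem exists_transverse_scaling : ∀ n, ∃ V : ℝ[X], V.natDegree ≤ n ∧
    ∀ s t : ℝ, s ^ 2 = 1 - t ^ 2 → C (s ^ n) * transverse n = C (V.eval t) * transverse n
  | 0 => ⟨1, by simp, by simp⟩
  | 1 => ⟨0, by simp, by simp [transverse]⟩
  | n + 2 => by
    obtain ⟨V, hV, h⟩ := exists_transverse_scaling n
    have h2 : (1 - X ^ 2 : ℝ[X]).natDegree ≤ 2 := by compute_degree
    refine ⟨(1 - X ^ 2) * V, natDegree_mul_le.trans (by omega), fun s t hst => ?_⟩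
    have e := h s t hst
    rw [transverse, pow_add, hst, C_mul, eval_mul, C_mul]
    simp only [eval_sub, eval_one, eval_pow, eval_X]
    linear_combination (C (((n : ℝ) + 1) / (n + 2)) * (1 - X ^ 2) * C (1 - t ^ 2)) * e

theorem RotationInvariant.integral_mul_coord_one_pow (hμ : RotationInvariant μ) :
    ∀ (n : ℕ) (g : ℝ[X]), ∫ y : S2, g.eval ((y : E3) 0) * (y : E3) 1 ^ n ∂μ =
      zonal μ (g * transverse n)
  | 0, g => by simp [transverse, zonal_apply]
  | 1, g => by simpa [transverse] using hμ.integral_mul_coord_one g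
  | n + 2, g => by
    rw [hμ.integral_mul_pow_succ_succ, hμ.integral_mul_coord_one_pow n, transverse,
      ← smul_eq_mul, ← map_smul, smul_eq_C_mul]
    congr 1
    ring

theorem RotationInvariant.zonal_derivative (hμ : RotationInvariant μ) (g : ℝ[X]) :
    zonal μ (derivative ((X ^ 2 - 1) * g)) = 0 := by
  have h := hμ.integral_rotate01 g
  rw [integral_sub (integrable_of_continuous (by fun_prop)) (integrable_of_continuous (by fun_prop)),
    hμ.integral_mul_coord_one_pow 2] at h
  have h1 : ∫ y : S2, g.eval ((y : E3) 0) * (y : E3) 0 ∂μ = zonal μ (g * X) := by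
    simp [zonal_apply]
  have e : derivative ((X ^ 2 - 1) * g) =
      (2 : ℝ) • (g * X) - (2 : ℝ) • (derivative g * transverse 2) := by
    have h2 : (C 2 : ℝ[X]) = 2 := rfl
    have h3 : (2 : ℝ[X]) * C 2⁻¹ = 1 := by rw [← h2, ← C_mul]; norm_num
    simp [transverse, smul_eq_C_mul, h2]
    linear_combination (derivative g * (1 - X ^ 2)) * h3
  rw [e, map_sub, map_smul, map_smul, ← smul_sub, ← h1, h, smul_zero]

theorem RotationInvariant.zonal_X_pow (hμ : RotationInvariant μ) :
    ∀ n : ℕ, zonal μ (X ^ n) = zonal μ 1 / 2 * ∫ u in (-1 : ℝ)..1, u ^ n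
  | 0 => by simp; ring
  | 1 => by
    have h := hμ.zonal_derivative 1
    have e : derivative ((X ^ 2 - 1) * 1 : ℝ[X]) = (2 : ℝ) • X := by
      have h2 : (C 2 : ℝ[X]) = 2 := rfl
      simp [smul_eq_C_mul, h2, one_add_one_eq_two]
    rw [e, map_smul, smul_eq_mul] at h
    simp
    linarith
  | n + 2 => by
    have h := hμ.zonal_derivative (X ^ (n + 1))
    have e : derivative ((X ^ 2 - 1) * X ^ (n + 1) : ℝ[X]) =
        ((n : ℝ) + 3) • X ^ (n + 2) - ((n : ℝ) + 1) • X ^ n := by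
      have h2 : (C 2 : ℝ[X]) = 2 := rfl
      have h3 : (C 3 : ℝ[X]) = 3 := rfl
      simp [smul_eq_C_mul, h3]
      ring
    rw [e, map_sub, map_smul, map_smul, hμ.zonal_X_pow n, integral_pow] at h
    rw [integral_pow]
    simp only [smul_eq_mul] at h
    push_cast
    have h1 : (n : ℝ) + 1 ≠ 0 := by positivity
    have h3 : (n : ℝ) + 3 ≠ 0 := by positivity
    have : (n : ℝ) + 2 + 1 ≠ 0 := by positivity
    field_simp at h ⊢
    rw [show n + 2 + 1 = (n + 1) + 2 by ring, pow_add (-1 : ℝ) (n + 1) 2]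
    simp only [one_pow, even_two, Even.neg_pow, mul_one] at h ⊢
    linear_combination h

theorem RotationInvariant.zonal_eq_intervalIntegral (hμ : RotationInvariant μ) (p : ℝ[X]) :
    zonal μ p = zonal μ 1 / 2 * ∫ u in (-1 : ℝ)..1, p.eval u := by
  induction p using Polynomial.induction_on' with
  | add p q hp hq =>
    simp only [map_add, eval_add]
    rw [intervalIntegral.integral_add (p.continuous.intervalIntegrable _ _)
      (q.continuous.intervalIntegrable _ _), hp, hq]
    ring
  | monomial n a =>
    rw [← C_mul_X_pow_eq_monomial, ← smul_eq_C_mul, map_smul, hμ.zonal_X_pow]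
    simp only [eval_smul, eval_pow, eval_X, smul_eq_mul, intervalIntegral.integral_const_mul]
    ring

theorem RotationInvariant.eq_zero_of_zonal_sq (hμ : RotationInvariant μ) (h1 : zonal μ 1 ≠ 0)
    {p : ℝ[X]} (hp : zonal μ (p * p) = 0) : p = 0 := by
  rw [hμ.zonal_eq_intervalIntegral, mul_eq_zero, or_iff_right (by simpa using h1)] at hp
  by_contra hne
  have hinf : (Set.Icc (-1 : ℝ) 1).Infinite := Set.Icc_infinite (by norm_num)
  have : ∃ c ∈ Set.Icc (-1 : ℝ) 1, p.eval c ≠ 0 := by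
    by_contra! h
    exact hne (eq_zero_of_infinite_isRoot p (hinf.mono h))
  obtain ⟨c, hc, hpc⟩ := this
  have := intervalIntegral.integral_pos (f := fun u => (p * p).eval u) (by norm_num)
    (p * p).continuous.continuousOn (fun u _ => by rw [eval_mul]; exact mul_self_nonneg _)
    ⟨c, hc, by rw [eval_mul]; exact mul_self_pos.mpr hpc⟩
  exact this.ne' hp

theorem RotationInvariant.integral_mul_eval_frame (hμ : RotationInvariant μ) (p q : ℝ[X])
    (t s : ℝ) :
    ∫ y : S2, p.eval ((y : E3) 0) * q.eval (t * (y : E3) 0 + s * (y : E3) 1) ∂μ =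
      ∑ m ∈ Finset.range (q.natDegree + 1), ∑ k ∈ Finset.range (m + 1),
        q.coeff m * m.choose k * t ^ k * s ^ (m - k) *
          zonal μ (p * X ^ k * transverse (m - k)) := by
  have e : ∀ y : S2, p.eval ((y : E3) 0) * q.eval (t * (y : E3) 0 + s * (y : E3) 1) =
      ∑ m ∈ Finset.range (q.natDegree + 1), ∑ k ∈ Finset.range (m + 1),
        q.coeff m * m.choose k * t ^ k * s ^ (m - k) *
          ((p * X ^ k).eval ((y : E3) 0) * (y : E3) 1 ^ (m - k)) := by
    intro y
    rw [eval_eq_sum_range (p := q), Finset.mul_sum]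
    refine Finset.sum_congr rfl fun m _ => ?_
    rw [add_pow, Finset.mul_sum, Finset.mul_sum]
    refine Finset.sum_congr rfl fun k _ => ?_
    rw [eval_mul, eval_pow, eval_X]
    ring
  simp_rw [e]
  rw [integral_finsetSum _ fun m _ => integrable_of_continuous (by fun_prop)]
  refine Finset.sum_congr rfl fun m _ => ?_
  rw [integral_finsetSum _ fun k _ => integrable_of_continuous (by fun_prop)]
  refine Finset.sum_congr rfl fun k _ => ?_
  rw [integral_const_mul, hμ.integral_mul_coord_one_pow]

theorem RotationInvariant.integral_mul_eval_frame_eq_zero (hμ : RotationInvariant μ) {l : ℕ}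
    {q : ℝ[X]} (hq : q.degree < l) (t s : ℝ) :
    ∫ y : S2, (legendreP l).eval ((y : E3) 0) * q.eval (t * (y : E3) 0 + s * (y : E3) 1) ∂μ = 0 := by
  rw [hμ.integral_mul_eval_frame]
  refine Finset.sum_eq_zero fun m hm => Finset.sum_eq_zero fun k hk => ?_
  rw [Finset.mem_range] at hm hk
  by_cases hql : m < l
  · rw [mul_assoc (legendreP l), legendreP_orthogonal hμ.zonal_derivative, mul_zero]
    refine lt_of_le_of_lt degree_le_natDegree ?_
    have h1 := natDegree_mul_le (p := (X ^ k : ℝ[X])) (q := transverse (m - k))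
    have h2 := natDegree_transverse_le (m - k)
    rw [natDegree_X_pow] at h1
    exact_mod_cast (by omega : (X ^ k * transverse (m - k)).natDegree < l)
  · rw [degree_lt_iff_coeff_zero] at hq
    simp [hq m (by omega)]

theorem RotationInvariant.exists_zonal_convolution (hμ : RotationInvariant μ) (p q : ℝ[X]) :
    ∃ Φ : ℝ[X], Φ.natDegree ≤ q.natDegree ∧ ∀ x z : S2,
      ∫ y : S2, p.eval (inner ℝ (x : E3) (y : E3)) * q.eval (inner ℝ (z : E3) (y : E3)) ∂μ =
        Φ.eval (inner ℝ (x : E3) (z : E3)) := by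
  choose V hVdeg hV using exists_transverse_scaling
  refine ⟨∑ m ∈ Finset.range (q.natDegree + 1), ∑ k ∈ Finset.range (m + 1),
    C (q.coeff m * m.choose k * zonal μ (p * X ^ k * transverse (m - k))) *
      (X ^ k * V (m - k)), ?_, fun x z => ?_⟩
  · refine natDegree_sum_le_of_forall_le _ _ fun m hm =>
      natDegree_sum_le_of_forall_le _ _ fun k hk => ?_
    rw [Finset.mem_range] at hm hk
    refine (natDegree_C_mul_le _ _).trans (natDegree_mul_le.trans ?_)
    have := hVdeg (m - k)
    rw [natDegree_X_pow]
    omega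
  · obtain ⟨s, hs, h⟩ := hμ.exists_integral_frame x z
    rw [h (fun a b => p.eval a * q.eval b) (by fun_prop), hμ.integral_mul_eval_frame]
    simp only [eval_finsetSum]
    refine Finset.sum_congr rfl fun m _ => Finset.sum_congr rfl fun k _ => ?_
    have e : s ^ (m - k) * zonal μ (p * X ^ k * transverse (m - k)) =
        (V (m - k)).eval (inner ℝ (x : E3) (z : E3)) *
          zonal μ (p * X ^ k * transverse (m - k)) := by
      have hC : ∀ (a : ℝ) (f : ℝ[X]), a * zonal μ f = zonal μ (C a * f) := fun a f => by
        rw [← smul_eq_C_mul, map_smul, smul_eq_mul]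
      rw [hC, hC]
      congr 1
      linear_combination (p * X ^ k) * hV (m - k) s _ hs
    simp only [eval_mul, eval_C, eval_pow, eval_X]
    linear_combination (q.coeff m * m.choose k * inner ℝ (x : E3) (z : E3) ^ k) * e

theorem RotationInvariant.integral_eval_inner (hμ : RotationInvariant μ) (p : ℝ[X]) (x : S2) :
    ∫ y : S2, p.eval (inner ℝ (x : E3) (y : E3)) ∂μ = zonal μ p := by
  obtain ⟨s, -, h⟩ := hμ.exists_integral_frame x x
  exact h (fun a _ => p.eval a) (by fun_prop)

/-- The reproducing property of the Legendre kernel on the sphere. -/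
theorem RotationInvariant.integral_legendreP_mul_legendreP (hμ : RotationInvariant μ)
    (h1 : zonal μ 1 ≠ 0) (l : ℕ) (x z : S2) :
    ∫ y : S2, (legendreP l).eval (inner ℝ (x : E3) (y : E3)) *
        (legendreP l).eval (inner ℝ (z : E3) (y : E3)) ∂μ =
      zonal μ 1 / (2 * l + 1) * (legendreP l).eval (inner ℝ (x : E3) (z : E3)) := by
  set P := legendreP l with hP
  obtain ⟨Φ, hdeg, hΦ⟩ := hμ.exists_zonal_convolution P P
  have horth : ∀ q : ℝ[X], q.degree < l → zonal μ (Φ * q) = 0 := by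
    intro q hq
    calc zonal μ (Φ * q)
        = ∫ w : S2, ∫ y : S2, P.eval (inner ℝ (x : E3) (y : E3)) *
            P.eval (inner ℝ (w : E3) (y : E3)) * q.eval (inner ℝ (x : E3) (w : E3)) ∂μ ∂μ := by
          rw [← hμ.integral_eval_inner _ x]
          refine integral_congr_ae (Eventually.of_forall fun w => ?_)
          simp only [integral_mul_const, eval_mul, hΦ]
      _ = ∫ y : S2, ∫ w : S2, P.eval (inner ℝ (x : E3) (y : E3)) *
            P.eval (inner ℝ (w : E3) (y : E3)) * q.eval (inner ℝ (x : E3) (w : E3)) ∂μ ∂μ := by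
          refine integral_integral_swap ?_
          have hc : Continuous (Function.uncurry fun w y : S2 => P.eval (inner ℝ (x : E3) (y : E3)) *
            P.eval (inner ℝ (w : E3) (y : E3)) * q.eval (inner ℝ (x : E3) (w : E3))) := by
            unfold Function.uncurry
            fun_prop
          rw [← integrableOn_univ]
          exact hc.continuousOn.integrableOn_compact isCompact_univ
      _ = 0 := by
          refine integral_eq_zero_of_ae (Eventually.of_forall fun y => ?_)
          obtain ⟨s, -, h⟩ := hμ.exists_integral_frame y x
          have := h (fun a b => P.eval a * q.eval b) (by fun_prop)
          rw [hμ.integral_mul_eval_frame_eq_zero hq] at this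
          simp only [mul_assoc, integral_const_mul, real_inner_comm (y : E3), Pi.zero_apply]
          rw [this, mul_zero]
  set c := Φ.coeff l / P.coeff l with hc
  have hr : (Φ - C c * P).degree < l := by
    rw [degree_lt_iff_coeff_zero]
    intro m hm
    rw [coeff_sub, coeff_C_mul]
    rcases hm.eq_or_lt with h | h
    · rw [← h, hc, div_mul_cancel₀ _ (legendreP_coeff_ne_zero l), sub_self]
    · have hPm := legendreP_natDegree_le l
      rw [coeff_eq_zero_of_natDegree_lt (lt_of_le_of_lt hPm h),
        coeff_eq_zero_of_natDegree_lt (lt_of_le_of_lt (hdeg.trans hPm) h)]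
      simp
  have hzero : Φ - C c * P = 0 := by
    refine hμ.eq_zero_of_zonal_sq h1 ?_
    nth_rewrite 1 [sub_mul]
    rw [mul_assoc, map_sub, horth _ hr, ← smul_eq_C_mul (p := P * _), map_smul,
      legendreP_orthogonal hμ.zonal_derivative hr]
    simp
  have hΦc : Φ = C c * P := sub_eq_zero.mp hzero
  have hxx : inner ℝ (x : E3) (x : E3) = 1 := by
    rw [real_inner_self_eq_norm_sq, mem_sphere_zero_iff_norm.mp x.2, one_pow]
  have hcv : c = zonal μ (P * P) := by
    have h := hΦ x x
    rw [hΦc, hxx] at h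
    simp only [eval_mul, eval_C, hP, legendreP_eval_one, mul_one] at h
    rw [← h, ← hμ.integral_eval_inner _ x]
    simp only [eval_mul, hP]
  have hn := legendreP_norm_sq hμ.zonal_derivative l
  rw [hΦ, hΦc, eval_mul, eval_C, hcv, ← hn, ← hP]
  field_simp

end SphereIntegrals

theorem iteratedDeriv_exp_sq (v : ℝ) (n : ℕ) :
    iteratedDeriv n (fun t : ℝ => rexp (v * t ^ 2 / 2)) = fun t =>
      ((fun p : ℝ[X] => derivative p + C v * X * p)^[n] 1).eval t * rexp (v * t ^ 2 / 2) := by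
  induction n with
  | zero => simp
  | succ n ih =>
    rw [iteratedDeriv_succ, ih, Function.iterate_succ_apply']
    ext t
    set p := (fun p : ℝ[X] => derivative p + C v * X * p)^[n] 1
    have h1 : HasDerivAt (fun t : ℝ => v * t ^ 2 / 2) (v * t) t := by
      have := (((hasDerivAt_pow 2 t).const_mul v).div_const 2)
      convert! this using 1
      simp; ring
    refine ((p.hasDerivAt t).mul h1.exp).deriv.trans ?_
    simp
    ring

theorem integral_pow_gaussianReal (v : NNReal) (n : ℕ) :
    ∫ x, x ^ n ∂(gaussianReal 0 v) =
      ((fun p : ℝ[X] => derivative p + C (v : ℝ) * X * p)^[n] 1).eval 0 := by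
  have h := iteratedDeriv_mgf_zero (X := id) (μ := gaussianReal 0 v) (by simp) n
  rw [mgf_id_gaussianReal] at h
  simp only [zero_mul, zero_add, iteratedDeriv_exp_sq] at h
  simpa using h.symm

theorem iterate_add_two_apply {α : Type*} (T : α → α) (n : ℕ) (x : α) :
    T^[n + 2] x = T (T (T^[n] x)) := by
  rw [Function.iterate_succ_apply', Function.iterate_succ_apply']

theorem iterate_two_gaussian (v : ℝ) :
    (fun p : ℝ[X] => derivative p + C v * X * p)^[2] 1 = C v + C v ^ 2 * X ^ 2 := by
  rw [iterate_add_two_apply _ 0, Function.iterate_zero_apply]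
  simp only [derivative_one, derivative_add, derivative_mul, derivative_C, derivative_X,
    derivative_zero]
  ring

theorem iterate_four_gaussian (v : ℝ) :
    (fun p : ℝ[X] => derivative p + C v * X * p)^[4] 1 =
      3 * C v ^ 2 + 6 * C v ^ 3 * X ^ 2 + C v ^ 4 * X ^ 4 := by
  rw [iterate_add_two_apply _ 2, iterate_two_gaussian]
  simp only [derivative_add, derivative_mul, derivative_C, derivative_X, derivative_pow,
    derivative_zero, derivative_one, derivative_natCast, C_eq_natCast]
  push_cast
  ring

theorem iterate_six_gaussian (v : ℝ) :
    (fun p : ℝ[X] => derivative p + C v * X * p)^[6] 1 =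
      15 * C v ^ 3 + 45 * C v ^ 4 * X ^ 2 + 15 * C v ^ 5 * X ^ 4 + C v ^ 6 * X ^ 6 := by
  rw [iterate_add_two_apply _ 4, iterate_four_gaussian]
  simp only [derivative_add, derivative_mul, derivative_C, derivative_X, derivative_pow,
    derivative_zero, derivative_one, derivative_natCast, derivative_ofNat, C_eq_natCast]
  push_cast
  ring

theorem iterate_eight_gaussian (v : ℝ) :
    (fun p : ℝ[X] => derivative p + C v * X * p)^[8] 1 =
      105 * C v ^ 4 + 420 * C v ^ 5 * X ^ 2 + 210 * C v ^ 6 * X ^ 4 + 28 * C v ^ 7 * X ^ 6 +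
        C v ^ 8 * X ^ 8 := by
  rw [iterate_add_two_apply _ 6, iterate_six_gaussian]
  simp only [derivative_add, derivative_mul, derivative_C, derivative_X, derivative_pow,
    derivative_zero, derivative_one, derivative_natCast, derivative_ofNat, C_eq_natCast]
  push_cast
  ring

section Moments

variable {Ω : Type*} [MeasurableSpace Ω] {P : Measure Ω} {X Y Z : Ω → ℝ} {v : NNReal}

theorem integral_pow_of_map_gaussianReal (hY : AEMeasurable Y P)
    (h : P.map Y = gaussianReal 0 v) (n : ℕ) :
    ∫ ω, Y ω ^ n ∂P =
      ((fun p : ℝ[X] => derivative p + C (v : ℝ) * Polynomial.X * p)^[n] 1).eval 0 := by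
  rw [← integral_pow_gaussianReal, ← h, integral_map hY (by fun_prop)]

theorem integral_sq_of_map_gaussianReal (hY : AEMeasurable Y P)
    (h : P.map Y = gaussianReal 0 v) : ∫ ω, Y ω ^ 2 ∂P = v := by
  rw [integral_pow_of_map_gaussianReal hY h, iterate_two_gaussian]
  simp

theorem integral_pow_four_of_map_gaussianReal (hY : AEMeasurable Y P)
    (h : P.map Y = gaussianReal 0 v) : ∫ ω, Y ω ^ 4 ∂P = 3 * v ^ 2 := by
  rw [integral_pow_of_map_gaussianReal hY h, iterate_four_gaussian]
  simp

theorem integral_pow_six_of_map_gaussianReal (hY : AEMeasurable Y P)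
    (h : P.map Y = gaussianReal 0 v) : ∫ ω, Y ω ^ 6 ∂P = 15 * v ^ 3 := by
  rw [integral_pow_of_map_gaussianReal hY h, iterate_six_gaussian]
  simp

theorem integral_pow_eight_of_map_gaussianReal (hY : AEMeasurable Y P)
    (h : P.map Y = gaussianReal 0 v) : ∫ ω, Y ω ^ 8 ∂P = 105 * v ^ 4 := by
  rw [integral_pow_of_map_gaussianReal hY h, iterate_eight_gaussian]
  simp

/-- The random variable `X` lies in every `L^p` space with `p` finite. -/
def HasAllMoments (P : Measure Ω) (X : Ω → ℝ) : Prop :=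
  ∀ p : ENNReal, p ≠ ⊤ → MemLp X p P

theorem HasAllMoments.mul (hX : HasAllMoments P X) (hY : HasAllMoments P Y) :
    HasAllMoments P (fun ω => X ω * Y ω) := by
  intro p hp
  have h2 : 2 * p ≠ ⊤ := ENNReal.mul_ne_top (by simp) hp
  have : ENNReal.HolderTriple (2 * p) (2 * p) p := ⟨by
    rw [← two_mul, ENNReal.mul_inv (by simp) (by simp), ← mul_assoc,
      ENNReal.mul_inv_cancel (by simp) (by simp), one_mul]⟩
  exact (hY _ h2).mul (hX _ h2)

theorem HasAllMoments.add (hX : HasAllMoments P X) (hY : HasAllMoments P Y) :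
    HasAllMoments P (fun ω => X ω + Y ω) := fun p hp => (hX p hp).add (hY p hp)

theorem HasAllMoments.const_mul (hX : HasAllMoments P X) (c : ℝ) :
    HasAllMoments P (fun ω => c * X ω) := fun p hp => (hX p hp).const_mul c

theorem HasAllMoments.integrable (hX : HasAllMoments P X) : Integrable X P :=
  memLp_one_iff_integrable.mp (hX 1 (by simp))

theorem hasAllMoments_of_map_gaussianReal (hY : AEMeasurable Y P)
    (h : P.map Y = gaussianReal 0 v) : HasAllMoments P Y := by
  intro p hp
  have := memLp_id_gaussianReal' (μ := 0) (v := v) p hp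
  rw [← h, memLp_map_measure_iff (by fun_prop) hY] at this
  exact this

variable [IsFiniteMeasure P]

theorem HasAllMoments.pow (hX : HasAllMoments P X) (n : ℕ) :
    HasAllMoments P (fun ω => X ω ^ n) := by
  induction n with
  | zero => exact fun p _ => by simpa using memLp_const (1 : ℝ)
  | succ n ih => simpa only [pow_succ] using ih.mul hX

theorem integral_mul_add_pow (hZ : HasAllMoments P Z) (hX : HasAllMoments P X)
    (hY : HasAllMoments P Y) (n : ℕ) (t : ℝ) :
    ∫ ω, Z ω * (t * X ω + Y ω) ^ n ∂P =
      ∑ k ∈ Finset.range (n + 1), (n.choose k * ∫ ω, Z ω * (X ω ^ k * Y ω ^ (n - k)) ∂P) * t ^ k := by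
  have e : ∀ ω, Z ω * (t * X ω + Y ω) ^ n = ∑ k ∈ Finset.range (n + 1),
      (n.choose k * t ^ k) * (Z ω * (X ω ^ k * Y ω ^ (n - k))) := by
    intro ω
    rw [add_pow, Finset.mul_sum]
    exact Finset.sum_congr rfl fun k _ => by ring
  simp_rw [e]
  rw [integral_finsetSum _ fun k _ =>
    ((hZ.mul ((hX.pow k).mul (hY.pow (n - k)))).const_mul _).integrable]
  refine Finset.sum_congr rfl fun k _ => ?_
  rw [integral_const_mul]
  ring

/-- The coefficient of `t ^ 2` in a quartic polynomial from its values at five nodes. -/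
theorem coeff_two_of_sum_range_five {a : ℕ → ℝ} {F : ℝ → ℝ}
    (h : ∀ t, ∑ k ∈ Finset.range 5, a k * t ^ k = F t) :
    a 2 = -5 / 4 * F 0 + 2 / 3 * (F 1 + F (-1)) - 1 / 24 * (F 2 + F (-2)) := by
  simp only [← h, Finset.sum_range_succ, Finset.sum_range_zero]
  ring

/-- The coefficient of `t ^ 2` in a sextic polynomial from its values at seven nodes. -/
theorem coeff_two_of_sum_range_seven {a : ℕ → ℝ} {F : ℝ → ℝ}
    (h : ∀ t, ∑ k ∈ Finset.range 7, a k * t ^ k = F t) :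
    a 2 = -49 / 36 * F 0 + 3 / 4 * (F 1 + F (-1)) - 3 / 40 * (F 2 + F (-2)) +
      1 / 180 * (F 3 + F (-3)) := by
  simp only [← h, Finset.sum_range_succ, Finset.sum_range_zero]
  ring

/-- The coefficient of `t ^ 2` in an octic polynomial from its values at nine nodes. -/
theorem coeff_two_of_sum_range_nine {a : ℕ → ℝ} {F : ℝ → ℝ}
    (h : ∀ t, ∑ k ∈ Finset.range 9, a k * t ^ k = F t) :
    a 2 = -205 / 144 * F 0 + 4 / 5 * (F 1 + F (-1)) - 1 / 10 * (F 2 + F (-2)) +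
      4 / 315 * (F 3 + F (-3)) - 1 / 1120 * (F 4 + F (-4)) := by
  simp only [← h, Finset.sum_range_succ, Finset.sum_range_zero]
  ring

theorem integral_mul_sq_mul_sq (hZ : HasAllMoments P Z) (hX : HasAllMoments P X)
    (hY : HasAllMoments P Y) {F : ℝ → ℝ} (h : ∀ t, ∫ ω, Z ω * (t * X ω + Y ω) ^ 4 ∂P = F t) :
    ∫ ω, Z ω * (X ω ^ 2 * Y ω ^ 2) ∂P =
      1 / 6 * (-5 / 4 * F 0 + 2 / 3 * (F 1 + F (-1)) - 1 / 24 * (F 2 + F (-2))) := by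
  have := coeff_two_of_sum_range_five fun t => (integral_mul_add_pow hZ hX hY 4 t).symm.trans (h t)
  rw [← this]
  norm_num [Nat.choose]
  ring

theorem integral_mul_sq_mul_pow_four (hZ : HasAllMoments P Z) (hX : HasAllMoments P X)
    (hY : HasAllMoments P Y) {F : ℝ → ℝ} (h : ∀ t, ∫ ω, Z ω * (t * X ω + Y ω) ^ 6 ∂P = F t) :
    ∫ ω, Z ω * (X ω ^ 2 * Y ω ^ 4) ∂P =
      1 / 15 * (-49 / 36 * F 0 + 3 / 4 * (F 1 + F (-1)) - 3 / 40 * (F 2 + F (-2)) +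
        1 / 180 * (F 3 + F (-3))) := by
  have := coeff_two_of_sum_range_seven fun t => (integral_mul_add_pow hZ hX hY 6 t).symm.trans (h t)
  rw [← this]
  norm_num [Nat.choose]
  ring

theorem integral_mul_sq_mul_pow_six (hZ : HasAllMoments P Z) (hX : HasAllMoments P X)
    (hY : HasAllMoments P Y) {F : ℝ → ℝ} (h : ∀ t, ∫ ω, Z ω * (t * X ω + Y ω) ^ 8 ∂P = F t) :
    ∫ ω, Z ω * (X ω ^ 2 * Y ω ^ 6) ∂P =
      1 / 28 * (-205 / 144 * F 0 + 4 / 5 * (F 1 + F (-1)) - 1 / 10 * (F 2 + F (-2)) +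
        4 / 315 * (F 3 + F (-3)) - 1 / 1120 * (F 4 + F (-4))) := by
  have := coeff_two_of_sum_range_nine fun t => (integral_mul_add_pow hZ hX hY 8 t).symm.trans (h t)
  rw [← this]
  norm_num [Nat.choose]
  ring

end Moments

section GaussianField

variable {Ω ι : Type*} [MeasurableSpace Ω] {P : Measure Ω} {X : ι → Ω → ℝ} {K : ι → ι → ℝ}

/-- A centered Gaussian family with unit variances and covariance `K`, described through its
linear combinations. -/
structure IsUnitGaussianFamily (P : Measure Ω) (X : ι → Ω → ℝ) (K : ι → ι → ℝ) : Prop where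
  measurable : ∀ i, Measurable (X i)
  self : ∀ i, K i i = 1
  comm : ∀ i j, K i j = K j i
  map_eq : ∀ (n : ℕ) (c : Fin n → ℝ) (x : Fin n → ι),
    P.map (fun ω => ∑ i, c i * X (x i) ω) =
      gaussianReal 0 (Real.toNNReal (∑ i, ∑ j, c i * c j * K (x i) (x j)))

namespace IsUnitGaussianFamily

theorem hasAllMoments (h : IsUnitGaussianFamily P X K) (i : ι) : HasAllMoments P (X i) := by
  have := h.map_eq 1 ![1] ![i]
  simp only [Fin.sum_univ_one, Matrix.cons_val_fin_one, one_mul] at this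
  exact hasAllMoments_of_map_gaussianReal (h.measurable i).aemeasurable this

theorem integral_sq_linear (h : IsUnitGaussianFamily P X K) (n : ℕ) (c : Fin n → ℝ)
    (x : Fin n → ι) : ∫ ω, (∑ i, c i * X (x i) ω) ^ 2 ∂P =
      max (∑ i, ∑ j, c i * c j * K (x i) (x j)) 0 := by
  have hm : Measurable fun ω => ∑ i, c i * X (x i) ω :=
    Finset.measurable_sum _ fun i _ => (h.measurable (x i)).const_mul _
  rw [integral_sq_of_map_gaussianReal hm.aemeasurable (h.map_eq n c x), Real.coe_toNNReal']

theorem integral_sq (h : IsUnitGaussianFamily P X K) (i : ι) : ∫ ω, X i ω ^ 2 ∂P = 1 := by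
  have := h.integral_sq_linear 1 ![1] ![i]
  simpa [h.self] using this

theorem integral_mul (h : IsUnitGaussianFamily P X K) (i j : ι) :
    ∫ ω, X i ω * X j ω ∂P = K i j := by
  have hadd := h.integral_sq_linear 2 ![1, 1] ![i, j]
  have hsub := h.integral_sq_linear 2 ![1, -1] ![i, j]
  simp only [Fin.sum_univ_two, Matrix.cons_val_zero, Matrix.cons_val_one, h.self, h.comm j i]
    at hadd hsub
  have hi := (h.hasAllMoments i)
  have hj := (h.hasAllMoments j)
  have hii := (hi.mul hi).integrable
  have hij := (hi.mul hj).integrable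
  have hjj := (hj.mul hj).integrable
  have key : ∀ s : ℝ, ∫ ω, (1 * X i ω + s * X j ω) ^ 2 ∂P =
      1 + 2 * s * (∫ ω, X i ω * X j ω ∂P) + s ^ 2 := by
    intro s
    have e : ∀ ω, (1 * X i ω + s * X j ω) ^ 2 =
        X i ω * X i ω + 2 * s * (X i ω * X j ω) + s ^ 2 * (X j ω * X j ω) := fun ω => by ring
    simp_rw [e]
    rw [integral_add (f := fun ω => X i ω * X i ω + 2 * s * (X i ω * X j ω))
      (hii.add (hij.const_mul _)) (hjj.const_mul _), integral_add hii (hij.const_mul _), integral_const_mul, integral_const_mul]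
    simp only [← sq, h.integral_sq]
    ring
  rw [key] at hadd hsub
  rcases max_cases (1 * 1 * 1 + 1 * 1 * K i j + (1 * 1 * K i j + 1 * 1 * 1)) 0 with h1 | h1 <;>
  rcases max_cases (1 * 1 * 1 + 1 * -1 * K i j + (-1 * 1 * K i j + -1 * -1 * 1)) 0 with h2 | h2 <;>
  linarith [h1.1, h1.2, h2.1, h2.2]

theorem quadratic_nonneg (h : IsUnitGaussianFamily P X K) (n : ℕ) (c : Fin n → ℝ)
    (x : Fin n → ι) : 0 ≤ ∑ i, ∑ j, c i * c j * K (x i) (x j) := by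
  have e : ∑ i, ∑ j, c i * c j * K (x i) (x j) = ∫ ω, (∑ i, c i * X (x i) ω) ^ 2 ∂P := by
    simp only [sq, Finset.sum_mul_sum]
    have hint : ∀ i j, Integrable (fun ω => c i * X (x i) ω * (c j * X (x j) ω)) P := fun i j =>
      (((h.hasAllMoments _).const_mul _).mul ((h.hasAllMoments _).const_mul _)).integrable
    rw [integral_finsetSum _ fun i _ => integrable_finsetSum _ fun j _ => hint i j]
    refine Finset.sum_congr rfl fun i _ => ?_
    rw [integral_finsetSum _ fun j _ => hint i j]
    refine Finset.sum_congr rfl fun j _ => ?_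
    rw [← h.integral_mul, ← integral_const_mul]
    exact integral_congr_ae (Eventually.of_forall fun ω => by ring)
  rw [e]
  exact integral_nonneg fun ω => sq_nonneg _

theorem map_four (h : IsUnitGaussianFamily P X K) (i j k l : ι) (a b c d : ℝ) :
    ∃ v : NNReal, (v : ℝ) = a ^ 2 + b ^ 2 + c ^ 2 + d ^ 2 + 2 * (a * b * K i j + a * c * K i k +
        a * d * K i l + b * c * K j k + b * d * K j l + c * d * K k l) ∧
      P.map (fun ω => a * X i ω + (b * X j ω + (c * X k ω + d * X l ω))) = gaussianReal 0 v := by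
  have hm := h.map_eq 4 ![a, b, c, d] ![i, j, k, l]
  have hq := h.quadratic_nonneg 4 ![a, b, c, d] ![i, j, k, l]
  have e : (fun ω => ∑ m, ![a, b, c, d] m * X (![i, j, k, l] m) ω) =
      fun ω => a * X i ω + (b * X j ω + (c * X k ω + d * X l ω)) := by
    ext ω
    simp [Fin.sum_univ_four]
    ring
  refine ⟨_, ?_, e ▸ hm⟩
  rw [Real.coe_toNNReal _ hq]
  simp [Fin.sum_univ_four, h.self, h.comm j i, h.comm k i, h.comm l i, h.comm k j, h.comm l j,
    h.comm l k]
  ring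

variable [IsFiniteMeasure P]

theorem integral_sq_mul_sq (h : IsUnitGaussianFamily P X K) (i j : ι) :
    ∫ ω, X i ω ^ 2 * X j ω ^ 2 ∂P = 1 + 2 * K i j ^ 2 := by
  have hi := h.hasAllMoments i
  have hj := h.hasAllMoments j
  have h1 : HasAllMoments P fun _ => (1 : ℝ) := fun p _ => memLp_const _
  have := integral_mul_sq_mul_sq h1 hi hj (F := fun t => 3 * (t ^ 2 + 1 + 2 * (t * K i j)) ^ 2)
    fun t => by
      obtain ⟨v, hv, hmap⟩ := h.map_four i j j j t 1 0 0
      simp only [zero_mul, add_zero, one_mul] at hmap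
      simp only [one_mul]
      have hm : Measurable fun ω => t * X i ω + X j ω :=
        ((h.measurable i).const_mul t).add (h.measurable j)
      rw [integral_pow_four_of_map_gaussianReal hm.aemeasurable hmap, hv]
      ring
  simp only [one_mul] at this
  rw [this]
  ring

theorem integral_sq_mul_sq_mul_sq (h : IsUnitGaussianFamily P X K) (i j k : ι) :
    ∫ ω, X i ω ^ 2 * (X j ω ^ 2 * X k ω ^ 2) ∂P =
      1 + 2 * (K i j ^ 2 + K i k ^ 2 + K j k ^ 2) + 8 * (K i j * K j k * K i k) := by
  have hi := h.hasAllMoments i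
  have hj := h.hasAllMoments j
  have hk := h.hasAllMoments k
  have h1 : HasAllMoments P fun _ => (1 : ℝ) := fun p _ => memLp_const _
  have step : ∀ s : ℝ, ∫ ω, X i ω ^ 2 * (s * X j ω + X k ω) ^ 4 ∂P =
      3 * (s ^ 2 + 2 * s * K j k + 1) ^ 2 +
        12 * (s * K i j + K i k) ^ 2 * (s ^ 2 + 2 * s * K j k + 1) := by
    intro s
    have := integral_mul_sq_mul_pow_four h1 hi ((hj.const_mul s).add hk)
      (F := fun t => 15 * (t ^ 2 + 2 * t * (s * K i j + K i k) + (s ^ 2 + 2 * s * K j k + 1)) ^ 3)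
      fun t => by
        obtain ⟨v, hv, hmap⟩ := h.map_four i j k k t s 1 0
        simp only [zero_mul, add_zero, one_mul] at hmap
        simp only [one_mul]
        have hm : Measurable fun ω => t * X i ω + (s * X j ω + X k ω) :=
          ((h.measurable i).const_mul t).add (((h.measurable j).const_mul s).add (h.measurable k))
        rw [integral_pow_six_of_map_gaussianReal hm.aemeasurable hmap, hv]
        ring
    simp only [one_mul] at this
    rw [this]
    ring
  rw [integral_mul_sq_mul_sq (hi.pow 2) hj hk step]
  ring

theorem integral_sq_mul_sq_mul_sq_mul_sq (h : IsUnitGaussianFamily P X K) (i j k l : ι) :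
    ∫ ω, X i ω ^ 2 * (X j ω ^ 2 * (X k ω ^ 2 * X l ω ^ 2)) ∂P =
      1 + 2 * (K i j ^ 2 + K i k ^ 2 + K i l ^ 2 + K j k ^ 2 + K j l ^ 2 + K k l ^ 2) +
      4 * (K i j ^ 2 * K k l ^ 2 + K i k ^ 2 * K j l ^ 2 + K i l ^ 2 * K j k ^ 2) +
      8 * (K i j * K j k * K i k + K i j * K j l * K i l + K i k * K k l * K i l +
        K j k * K k l * K j l) +
      16 * (K i j * K j k * K k l * K i l + K i j * K j l * K k l * K i k +
        K i k * K j k * K j l * K i l) := by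
  have hi := h.hasAllMoments i
  have hj := h.hasAllMoments j
  have hk := h.hasAllMoments k
  have hl := h.hasAllMoments l
  have h1 : HasAllMoments P fun _ => (1 : ℝ) := fun p _ => memLp_const _
  have step1 : ∀ b c d : ℝ, ∫ ω, X i ω ^ 2 * (b * X j ω + (c * X k ω + d * X l ω)) ^ 6 ∂P =
      15 * (b ^ 2 + c ^ 2 + d ^ 2 + 2 * (b * c * K j k + b * d * K j l + c * d * K k l)) ^ 3 +
        90 * (b * K i j + c * K i k + d * K i l) ^ 2 *
          (b ^ 2 + c ^ 2 + d ^ 2 + 2 * (b * c * K j k + b * d * K j l + c * d * K k l)) ^ 2 := by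
    intro b c d
    have := integral_mul_sq_mul_pow_six h1 hi
      ((hj.const_mul b).add ((hk.const_mul c).add (hl.const_mul d)))
      (F := fun t => 105 * (t ^ 2 + 2 * t * (b * K i j + c * K i k + d * K i l) +
        (b ^ 2 + c ^ 2 + d ^ 2 + 2 * (b * c * K j k + b * d * K j l + c * d * K k l))) ^ 4)
      fun t => by
        obtain ⟨v, hv, hmap⟩ := h.map_four i j k l t b c d
        simp only [one_mul]
        have hm : Measurable fun ω => t * X i ω + (b * X j ω + (c * X k ω + d * X l ω)) :=
          ((h.measurable i).const_mul t).add (((h.measurable j).const_mul b).add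
            (((h.measurable k).const_mul c).add ((h.measurable l).const_mul d)))
        rw [integral_pow_eight_of_map_gaussianReal hm.aemeasurable hmap, hv]
        congr 2
        ring
    simp only [one_mul] at this
    rw [this]
    generalize b * K i j + c * K i k + d * K i l = u
    generalize b ^ 2 + c ^ 2 + d ^ 2 + 2 * (b * c * K j k + b * d * K j l + c * d * K k l) = q
    ring
  have step2 : ∀ c : ℝ, ∫ ω, X i ω ^ 2 * (X j ω ^ 2 * (c * X k ω + X l ω) ^ 4) ∂P =
      (fun m u q => 3 * q ^ 2 + 12 * m ^ 2 * q +
        6 * (K i j ^ 2 * q ^ 2 + 8 * (K i j * u * m * q) + 2 * u ^ 2 * q + 4 * u ^ 2 * m ^ 2))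
        (c * K j k + K j l) (c * K i k + K i l) (c ^ 2 + 2 * c * K k l + 1) := by
    intro c
    have := integral_mul_sq_mul_pow_four (hi.pow 2) hj ((hk.const_mul c).add hl)
      (F := fun b => 15 * (b ^ 2 + 2 * b * (c * K j k + K j l) + (c ^ 2 + 2 * c * K k l + 1)) ^ 3 +
        90 * (b * K i j + (c * K i k + K i l)) ^ 2 *
          (b ^ 2 + 2 * b * (c * K j k + K j l) + (c ^ 2 + 2 * c * K k l + 1)) ^ 2)
      fun b => by
        have := step1 b c 1
        simp only [one_mul] at this
        rw [this, show b ^ 2 + c ^ 2 + 1 ^ 2 + 2 * (b * c * K j k + b * 1 * K j l + c * 1 * K k l) =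
          b ^ 2 + 2 * b * (c * K j k + K j l) + (c ^ 2 + 2 * c * K k l + 1) by ring, add_assoc (b * K i j)]
    rw [this]
    generalize c * K j k + K j l = m
    generalize c * K i k + K i l = u
    generalize c ^ 2 + 2 * c * K k l + 1 = q
    ring
  have := integral_mul_sq_mul_sq ((hi.pow 2).mul (hj.pow 2)) hk hl
    fun c => (integral_congr_ae (Eventually.of_forall fun ω => by ring)).trans (step2 c)
  have e : ∀ ω, X i ω ^ 2 * (X j ω ^ 2 * (X k ω ^ 2 * X l ω ^ 2)) =
      X i ω ^ 2 * X j ω ^ 2 * (X k ω ^ 2 * X l ω ^ 2) := fun ω => by ring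
  simp_rw [e]
  rw [this]
  ring

end IsUnitGaussianFamily

end GaussianField

section ReproducingKernel

variable {Ω : Type*} [MeasurableSpace Ω] {P : Measure Ω} {μ : Measure S2} {K : S2 → S2 → ℝ} {κ : ℝ}

/-- A continuous symmetric kernel with unit diagonal that reproduces itself under convolution,
up to the factor `κ`. -/
structure IsReproducingKernel (μ : Measure S2) (K : S2 → S2 → ℝ) (κ : ℝ) : Prop where
  continuous : Continuous fun p : S2 × S2 => K p.1 p.2
  self : ∀ x, K x x = 1
  comm : ∀ x y, K x y = K y x
  integral_mul : ∀ x z, ∫ y, K x y * K z y ∂μ = κ * K x z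
  nonneg : 0 ≤ κ

/-- The mixed moment `E[X²Y²Z²]` of unit Gaussian variables with covariances `a`, `b`, `c`. -/
def sqMoment (a b c : ℝ) : ℝ := 1 + 2 * (a ^ 2 + b ^ 2 + c ^ 2) + 8 * (a * c * b)

namespace IsReproducingKernel

theorem continuous_right (hK : IsReproducingKernel μ K κ) (x : S2) : Continuous (K x) :=
  hK.continuous.comp (by fun_prop : Continuous fun y : S2 => (x, y))

variable [IsFiniteMeasure μ]

theorem integral_quadratic (hK : IsReproducingKernel μ K κ) (x y z : S2) (a b c d p q r : ℝ) :
    ∫ w, (a + b * (K x w * K x w) + c * (K y w * K y w) + d * (K z w * K z w) +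
        p * (K x w * K y w) + q * (K x w * K z w) + r * (K y w * K z w)) ∂μ =
      a * μ.real Set.univ + κ * (b + c + d + p * K x y + q * K x z + r * K y z) := by
  have hx := hK.continuous_right x
  have hy := hK.continuous_right y
  have hz := hK.continuous_right z
  rw [integral_add (integrable_of_continuous (by fun_prop)) (integrable_of_continuous (by fun_prop)),
    integral_add (integrable_of_continuous (by fun_prop)) (integrable_of_continuous (by fun_prop)),
    integral_add (integrable_of_continuous (by fun_prop)) (integrable_of_continuous (by fun_prop)),
    integral_add (integrable_of_continuous (by fun_prop)) (integrable_of_continuous (by fun_prop)),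
    integral_add (integrable_of_continuous (by fun_prop)) (integrable_of_continuous (by fun_prop)),
    integral_add (integrable_of_continuous (by fun_prop)) (integrable_of_continuous (by fun_prop))]
  simp only [integral_const_mul, hK.integral_mul, hK.self, integral_const, smul_eq_mul]
  ring

theorem integral_moment_two (hK : IsReproducingKernel μ K κ) (x : S2) :
    ∫ y, (1 + 2 * K x y ^ 2) ∂μ = μ.real Set.univ + 2 * κ := by
  have := hK.integral_quadratic x x x 1 2 0 0 0 0 0
  simp only [zero_mul, add_zero, ← sq] at this
  rw [this]
  ring

theorem integral_moment_three (hK : IsReproducingKernel μ K κ) (x y : S2) :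
    ∫ z, sqMoment (K x y) (K x z) (K y z) ∂μ = (μ.real Set.univ + 4 * κ) * (1 + 2 * K x y ^ 2) := by
  have := hK.integral_quadratic x y y (1 + 2 * K x y ^ 2) 2 2 0 (8 * K x y) 0 0
  have e : ∀ z, sqMoment (K x y) (K x z) (K y z) = 1 + 2 * K x y ^ 2 + 2 * (K x z * K x z) +
      2 * (K y z * K y z) + 0 * (K y z * K y z) + 8 * K x y * (K x z * K y z) +
      0 * (K x z * K y z) + 0 * (K y z * K y z) := fun z => by rw [sqMoment]; ring
  simp_rw [e]
  rw [this]
  ring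

theorem integral_moment_four (hK : IsReproducingKernel μ K κ) (x y z : S2) :
    ∫ w, (1 + 2 * (K x y ^ 2 + K x z ^ 2 + K x w ^ 2 + K y z ^ 2 + K y w ^ 2 + K z w ^ 2) +
      4 * (K x y ^ 2 * K z w ^ 2 + K x z ^ 2 * K y w ^ 2 + K x w ^ 2 * K y z ^ 2) +
      8 * (K x y * K y z * K x z + K x y * K y w * K x w + K x z * K z w * K x w +
        K y z * K z w * K y w) +
      16 * (K x y * K y z * K z w * K x w + K x y * K y w * K z w * K x z +
        K x z * K y z * K y w * K x w)) ∂μ =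
      (μ.real Set.univ + 6 * κ) * sqMoment (K x y) (K x z) (K y z) := by
  have := hK.integral_quadratic x y z (sqMoment (K x y) (K x z) (K y z))
    (2 + 4 * K y z ^ 2) (2 + 4 * K x z ^ 2) (2 + 4 * K x y ^ 2)
    (8 * K x y + 16 * (K x z * K y z)) (8 * K x z + 16 * (K x y * K y z))
    (8 * K y z + 16 * (K x y * K x z))
  calc _ = _ := integral_congr_ae (Eventually.of_forall fun w => by
          simp only [sqMoment]
          ring)
    _ = _ := this
    _ = _ := by simp only [sqMoment]; ring

end IsReproducingKernel

/-- The energy `∫ f_x(ω)² dμ(x)` of a sample of a random field. -/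
noncomputable def energy (μ : Measure S2) (f : S2 → Ω → ℝ) (ω : Ω) : ENNReal :=
  ∫⁻ x, ENNReal.ofReal (f x ω ^ 2) ∂μ

variable {f : S2 → Ω → ℝ}

theorem measurable_energy [SFinite μ] (hf : Measurable (Function.uncurry f)) :
    Measurable (energy μ f) :=
  Measurable.lintegral_prod_left' (f := fun p : S2 × Ω => ENNReal.ofReal (f p.1 p.2 ^ 2))
    (hf.pow_const 2).ennreal_ofReal

theorem measurable_ofReal_sq (hf : Measurable (Function.uncurry f)) (x : S2) :
    Measurable fun ω => ENNReal.ofReal (f x ω ^ 2) :=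
  ((hf.comp measurable_prodMk_left).pow_const 2).ennreal_ofReal

/-- Tonelli's theorem for the product of the energy with another nonnegative variable. -/
theorem lintegral_mul_energy [SFinite μ] [SFinite P] (hf : Measurable (Function.uncurry f))
    {F : Ω → ENNReal} (hF : Measurable F) {φ : S2 → ℝ} (hφ : Integrable φ μ) (h0 : ∀ x, 0 ≤ φ x)
    (h : ∀ x, ∫⁻ ω, F ω * ENNReal.ofReal (f x ω ^ 2) ∂P = ENNReal.ofReal (φ x)) :
    ∫⁻ ω, F ω * energy μ f ω ∂P = ENNReal.ofReal (∫ x, φ x ∂μ) := by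
  have hm : Measurable fun p : Ω × S2 => F p.1 * ENNReal.ofReal (f p.2 p.1 ^ 2) :=
    (hF.comp measurable_fst).mul ((hf.comp measurable_swap).pow_const 2).ennreal_ofReal
  calc ∫⁻ ω, F ω * energy μ f ω ∂P
      = ∫⁻ ω, ∫⁻ x, F ω * ENNReal.ofReal (f x ω ^ 2) ∂μ ∂P := by
        refine lintegral_congr fun ω => (lintegral_const_mul _ ?_).symm
        exact ((hf.comp measurable_prodMk_right).pow_const 2).ennreal_ofReal
    _ = ∫⁻ x, ∫⁻ ω, F ω * ENNReal.ofReal (f x ω ^ 2) ∂P ∂μ :=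
        lintegral_lintegral_swap hm.aemeasurable
    _ = ENNReal.ofReal (∫ x, φ x ∂μ) := by
        simp_rw [h]
        exact (ofReal_integral_eq_lintegral_ofReal hφ (Eventually.of_forall h0)).symm

namespace IsUnitGaussianFamily

variable [IsProbabilityMeasure P]

theorem lintegral_one (h : IsUnitGaussianFamily P f K) (x : S2) :
    ∫⁻ ω, ENNReal.ofReal (f x ω ^ 2) ∂P = ENNReal.ofReal 1 := by
  rw [← h.integral_sq x, ofReal_integral_eq_lintegral_ofReal ((h.hasAllMoments x).pow 2).integrable
    (Eventually.of_forall fun ω => sq_nonneg _)]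

theorem lintegral_two (h : IsUnitGaussianFamily P f K) (x y : S2) :
    ∫⁻ ω, ENNReal.ofReal (f x ω ^ 2) * ENNReal.ofReal (f y ω ^ 2) ∂P =
      ENNReal.ofReal (1 + 2 * K x y ^ 2) := by
  have hm := fun x => (h.hasAllMoments x).pow 2
  rw [← h.integral_sq_mul_sq x y, ofReal_integral_eq_lintegral_ofReal
    ((hm x).mul (hm y)).integrable (Eventually.of_forall fun ω => by positivity)]
  exact lintegral_congr fun ω => (ENNReal.ofReal_mul (sq_nonneg _)).symm

theorem sqMoment_nonneg (h : IsUnitGaussianFamily P f K) (x y z : S2) :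
    0 ≤ sqMoment (K x y) (K x z) (K y z) := by
  have := h.integral_sq_mul_sq_mul_sq x y z
  rw [sqMoment, ← this]
  exact integral_nonneg fun ω => by positivity

theorem lintegral_three (h : IsUnitGaussianFamily P f K) (x y z : S2) :
    ∫⁻ ω, ENNReal.ofReal (f x ω ^ 2) * ENNReal.ofReal (f y ω ^ 2) *
      ENNReal.ofReal (f z ω ^ 2) ∂P = ENNReal.ofReal (sqMoment (K x y) (K x z) (K y z)) := by
  have hm := fun x => (h.hasAllMoments x).pow 2
  rw [sqMoment, ← h.integral_sq_mul_sq_mul_sq x y z, ofReal_integral_eq_lintegral_ofReal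
    ((hm x).mul ((hm y).mul (hm z))).integrable (Eventually.of_forall fun ω => by positivity)]
  refine lintegral_congr fun ω => ?_
  rw [ENNReal.ofReal_mul (sq_nonneg _), ENNReal.ofReal_mul (sq_nonneg _), mul_assoc]

variable [IsFiniteMeasure μ]

theorem lintegral_three_mul_energy (h : IsUnitGaussianFamily P f K)
    (hK : IsReproducingKernel μ K κ) (hf : Measurable (Function.uncurry f)) (x y z : S2) :
    ∫⁻ ω, ENNReal.ofReal (f x ω ^ 2) * ENNReal.ofReal (f y ω ^ 2) *
      ENNReal.ofReal (f z ω ^ 2) * energy μ f ω ∂P =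
      ENNReal.ofReal ((μ.real Set.univ + 6 * κ) * sqMoment (K x y) (K x z) (K y z)) := by
  have hg := measurable_ofReal_sq hf
  have hm := fun x => (h.hasAllMoments x).pow 2
  rw [← hK.integral_moment_four x y z]
  have hx := hK.continuous_right x
  have hy := hK.continuous_right y
  have hz := hK.continuous_right z
  refine lintegral_mul_energy hf (((hg x).mul (hg y)).mul (hg z))
    (integrable_of_continuous (by fun_prop)) ?_ ?_
  · intro w
    rw [← h.integral_sq_mul_sq_mul_sq_mul_sq x y z w]
    exact integral_nonneg fun ω => by positivity
  · intro w
    rw [← h.integral_sq_mul_sq_mul_sq_mul_sq x y z w, ofReal_integral_eq_lintegral_ofReal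
      ((hm x).mul ((hm y).mul ((hm z).mul (hm w)))).integrable
      (Eventually.of_forall fun ω => by positivity)]
    refine lintegral_congr fun ω => ?_
    rw [ENNReal.ofReal_mul (sq_nonneg _), ENNReal.ofReal_mul (sq_nonneg _),
      ENNReal.ofReal_mul (sq_nonneg _), Pi.mul_apply, Pi.mul_apply]
    ring

/-- If the moments of `F` against the squares at `x`, `y` and any third point are known up to a
constant factor, then so is the moment with the third square replaced by the energy. -/
theorem lintegral_two_mul_energy (h : IsUnitGaussianFamily P f K)
    (hK : IsReproducingKernel μ K κ) (hf : Measurable (Function.uncurry f)) {F : Ω → ENNReal}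
    (hF : Measurable F) {c : ℝ} (hc : 0 ≤ c) (x y : S2)
    (h3 : ∀ z, ∫⁻ ω, ENNReal.ofReal (f x ω ^ 2) * ENNReal.ofReal (f y ω ^ 2) *
      ENNReal.ofReal (f z ω ^ 2) * F ω ∂P =
      ENNReal.ofReal (c * sqMoment (K x y) (K x z) (K y z))) :
    ∫⁻ ω, ENNReal.ofReal (f x ω ^ 2) * ENNReal.ofReal (f y ω ^ 2) * (F ω * energy μ f ω) ∂P =
      ENNReal.ofReal (c * (μ.real Set.univ + 4 * κ) * (1 + 2 * K x y ^ 2)) := by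
  have hg := measurable_ofReal_sq hf
  have hx := hK.continuous_right x
  have hy := hK.continuous_right y
  have hcont : Continuous fun z => c * sqMoment (K x y) (K x z) (K y z) := by
    unfold sqMoment
    fun_prop
  have := lintegral_mul_energy hf (((hg x).mul (hg y)).mul hF) (integrable_of_continuous (μ := μ) hcont)
    (fun z => mul_nonneg hc (h.sqMoment_nonneg x y z)) fun z => by
      rw [← h3 z]
      exact lintegral_congr fun ω => by simp only [Pi.mul_apply]; ring
  rw [integral_const_mul, hK.integral_moment_three] at this
  rw [mul_assoc c, ← this]
  exact lintegral_congr fun ω => by simp only [Pi.mul_apply]; ring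

theorem lintegral_one_mul_energy (hK : IsReproducingKernel μ K κ)
    (hf : Measurable (Function.uncurry f)) {F : Ω → ENNReal}
    (hF : Measurable F) {c : ℝ} (hc : 0 ≤ c) (x : S2)
    (h2 : ∀ y, ∫⁻ ω, ENNReal.ofReal (f x ω ^ 2) * ENNReal.ofReal (f y ω ^ 2) * F ω ∂P =
      ENNReal.ofReal (c * (1 + 2 * K x y ^ 2))) :
    ∫⁻ ω, ENNReal.ofReal (f x ω ^ 2) * (F ω * energy μ f ω) ∂P =
      ENNReal.ofReal (c * (μ.real Set.univ + 2 * κ)) := by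
  have hg := measurable_ofReal_sq hf
  have hx := hK.continuous_right x
  have := lintegral_mul_energy (P := P) hf ((hg x).mul hF)
    (integrable_of_continuous (μ := μ) (F := fun y => c * (1 + 2 * K x y ^ 2)) (by fun_prop))
    (fun y => by positivity) fun y => by
      rw [← h2 y]
      exact lintegral_congr fun ω => by simp only [Pi.mul_apply]; ring
  rw [integral_const_mul, hK.integral_moment_two] at this
  rw [← this]
  exact lintegral_congr fun ω => by simp only [Pi.mul_apply]; ring

theorem lintegral_energy_of_const (hf : Measurable (Function.uncurry f)) {F : Ω → ENNReal}
    (hF : Measurable F) {c : ℝ} (hc : 0 ≤ c)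
    (h1 : ∀ x, ∫⁻ ω, ENNReal.ofReal (f x ω ^ 2) * F ω ∂P = ENNReal.ofReal c) :
    ∫⁻ ω, F ω * energy μ f ω ∂P = ENNReal.ofReal (c * μ.real Set.univ) := by
  rw [lintegral_mul_energy hf hF (integrable_const c) (fun _ => hc)
    fun x => by rw [← h1 x]; simp_rw [mul_comm]]
  rw [integral_const, smul_eq_mul, mul_comm]

theorem lintegral_energy (h : IsUnitGaussianFamily P f K) (hf : Measurable (Function.uncurry f)) :
    ∫⁻ ω, energy μ f ω ∂P = ENNReal.ofReal (μ.real Set.univ) := by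
  have := lintegral_energy_of_const (P := P) (μ := μ) hf (F := fun _ => 1) measurable_const
    zero_le_one fun x => by simpa using h.lintegral_one x
  simpa using this

theorem lintegral_energy_sq (h : IsUnitGaussianFamily P f K) (hK : IsReproducingKernel μ K κ)
    (hf : Measurable (Function.uncurry f)) :
    ∫⁻ ω, energy μ f ω ^ 2 ∂P =
      ENNReal.ofReal ((μ.real Set.univ + 2 * κ) * μ.real Set.univ) := by
  have hκ := hK.nonneg
  simp_rw [sq]
  refine lintegral_energy_of_const hf (measurable_energy hf) (by positivity) fun x => ?_
  simpa using lintegral_one_mul_energy (P := P) hK hf (F := fun _ => 1) measurable_const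
    zero_le_one x fun y => by simpa using h.lintegral_two x y

theorem lintegral_energy_pow_three (h : IsUnitGaussianFamily P f K)
    (hK : IsReproducingKernel μ K κ) (hf : Measurable (Function.uncurry f)) :
    ∫⁻ ω, energy μ f ω ^ 3 ∂P = ENNReal.ofReal
      ((μ.real Set.univ + 4 * κ) * (μ.real Set.univ + 2 * κ) * μ.real Set.univ) := by
  have hκ := hK.nonneg
  have hE := measurable_energy (μ := μ) hf
  simp_rw [pow_succ _ 2, sq]
  refine lintegral_energy_of_const hf (hE.mul hE) (by positivity) fun x => ?_
  refine lintegral_one_mul_energy hK hf hE (by positivity) x fun y => ?_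
  simpa using h.lintegral_two_mul_energy hK hf (F := fun _ => 1) measurable_const
    zero_le_one x y fun z => by simpa using h.lintegral_three x y z

theorem lintegral_energy_pow_four (h : IsUnitGaussianFamily P f K)
    (hK : IsReproducingKernel μ K κ) (hf : Measurable (Function.uncurry f)) :
    ∫⁻ ω, energy μ f ω ^ 4 ∂P = ENNReal.ofReal ((μ.real Set.univ + 6 * κ) *
      (μ.real Set.univ + 4 * κ) * (μ.real Set.univ + 2 * κ) * μ.real Set.univ) := by
  have hκ := hK.nonneg
  have hE := measurable_energy (μ := μ) hf
  simp_rw [pow_succ _ 3, pow_succ _ 2, sq]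
  refine lintegral_energy_of_const hf ((hE.mul hE).mul hE) (by positivity) fun x => ?_
  refine lintegral_one_mul_energy hK hf (hE.mul hE) (by positivity) x fun y => ?_
  refine h.lintegral_two_mul_energy hK hf hE (by positivity) x y fun z => ?_
  exact h.lintegral_three_mul_energy hK hf x y z

end IsUnitGaussianFamily

end ReproducingKernel

section CenteredEnergy

variable {Ω : Type*} [MeasurableSpace Ω] {P : Measure Ω}

/-- Integrability and value of a moment of `E.toReal` from the corresponding lower integral. -/
theorem integral_toReal_pow {E : Ω → ENNReal} (hE : Measurable E) (hfin : ∀ᵐ ω ∂P, E ω < ⊤)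
    {n : ℕ} {m : ℝ} (hm : 0 ≤ m) (h : ∫⁻ ω, E ω ^ n ∂P = ENNReal.ofReal m) :
    Integrable (fun ω => (E ω).toReal ^ n) P ∧ ∫ ω, (E ω).toReal ^ n ∂P = m := by
  simp_rw [← ENNReal.toReal_pow]
  have hEn := (hE.pow_const n).aemeasurable (μ := P)
  refine ⟨integrable_toReal_of_lintegral_ne_top hEn (h ▸ ENNReal.ofReal_ne_top), ?_⟩
  rw [integral_toReal hEn (hfin.mono fun ω hω => ENNReal.pow_lt_top hω), h,
    ENNReal.toReal_ofReal hm]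

variable [IsProbabilityMeasure P] {μ : Measure S2} [IsFiniteMeasure μ] {K : S2 → S2 → ℝ} {κ : ℝ} {f : S2 → Ω → ℝ}

theorem integral_sq_sub_one_of_energy_lt_top (hf : Measurable (Function.uncurry f)) {ω : Ω}
    (h : energy μ f ω < ⊤) :
    ∫ x, (f x ω ^ 2 - 1) ∂μ = (energy μ f ω).toReal - μ.real Set.univ := by
  have hm : Measurable fun x => f x ω ^ 2 := (hf.comp measurable_prodMk_right).pow_const 2
  have hint : Integrable (fun x => f x ω ^ 2) μ := by
    have := integrable_toReal_of_lintegral_ne_top hm.ennreal_ofReal.aemeasurable h.ne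
    simpa only [ENNReal.toReal_ofReal (sq_nonneg _)] using this
  rw [integral_sub hint (integrable_const 1), integral_eq_lintegral_of_nonneg_ae
    (Eventually.of_forall fun x => sq_nonneg _) hm.aestronglyMeasurable, energy]
  simp

theorem IsUnitGaussianFamily.moments_centered_energy (h : IsUnitGaussianFamily P f K)
    (hK : IsReproducingKernel μ K κ) (hf : Measurable (Function.uncurry f)) :
    variance (fun ω => ∫ x, (f x ω ^ 2 - 1) ∂μ) P = 2 * κ * μ.real Set.univ ∧
    ∫ ω, (∫ x, (f x ω ^ 2 - 1) ∂μ) ^ 2 ∂P = 2 * κ * μ.real Set.univ ∧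
    ∫ ω, (∫ x, (f x ω ^ 2 - 1) ∂μ) ^ 4 ∂P =
      12 * κ ^ 2 * μ.real Set.univ ^ 2 + 48 * κ ^ 3 * μ.real Set.univ := by
  have hκ := hK.nonneg
  have hE : Measurable (energy μ f) := measurable_energy hf
  have hfin : ∀ᵐ ω ∂P, energy μ f ω < ⊤ :=
    ae_lt_top hE (h.lintegral_energy (μ := μ) hf ▸ ENNReal.ofReal_ne_top)
  obtain ⟨i1, m1⟩ := integral_toReal_pow (n := 1) hE hfin (m := μ.real Set.univ) (by positivity)
    (by simpa only [pow_one] using h.lintegral_energy hf)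
  obtain ⟨i2, m2⟩ := integral_toReal_pow hE hfin (by positivity) (h.lintegral_energy_sq hK hf)
  obtain ⟨i3, m3⟩ := integral_toReal_pow hE hfin (by positivity)
    (h.lintegral_energy_pow_three hK hf)
  obtain ⟨i4, m4⟩ := integral_toReal_pow hE hfin (by positivity)
    (h.lintegral_energy_pow_four hK hf)
  have hae : (fun ω => ∫ x, (f x ω ^ 2 - 1) ∂μ) =ᵐ[P]
      fun ω => (energy μ f ω).toReal - μ.real Set.univ :=
    hfin.mono fun ω hω => integral_sq_sub_one_of_energy_lt_top hf hω
  set T := μ.real Set.univ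
  have e2 : ∫ ω, ((energy μ f ω).toReal - T) ^ 2 ∂P = 2 * κ * T := by
    have e : ∀ ω, ((energy μ f ω).toReal - T) ^ 2 = (energy μ f ω).toReal ^ 2 +
        (-2 * T) * (energy μ f ω).toReal ^ 1 + T ^ 2 := fun ω => by ring
    simp_rw [e]
    have j2 : Integrable (fun ω => (energy μ f ω).toReal ^ 2 +
        (-2 * T) * (energy μ f ω).toReal ^ 1) P := i2.add (i1.const_mul _)
    rw [integral_add j2 (integrable_const _), integral_add i2 (i1.const_mul _), integral_const_mul, m1, m2]
    simp
    ring
  have e4 : ∫ ω, ((energy μ f ω).toReal - T) ^ 4 ∂P = 12 * κ ^ 2 * T ^ 2 + 48 * κ ^ 3 * T := by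
    have e : ∀ ω, ((energy μ f ω).toReal - T) ^ 4 = (energy μ f ω).toReal ^ 4 +
        (-4 * T) * (energy μ f ω).toReal ^ 3 + (6 * T ^ 2) * (energy μ f ω).toReal ^ 2 +
        (-4 * T ^ 3) * (energy μ f ω).toReal ^ 1 + T ^ 4 := fun ω => by ring
    simp_rw [e]
    have j3 : Integrable (fun ω => (energy μ f ω).toReal ^ 4 +
        (-4 * T) * (energy μ f ω).toReal ^ 3) P := i4.add (i3.const_mul _)
    have j2 : Integrable (fun ω => (energy μ f ω).toReal ^ 4 +
        (-4 * T) * (energy μ f ω).toReal ^ 3 + (6 * T ^ 2) * (energy μ f ω).toReal ^ 2) P :=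
      j3.add (i2.const_mul _)
    have j1 : Integrable (fun ω => (energy μ f ω).toReal ^ 4 +
        (-4 * T) * (energy μ f ω).toReal ^ 3 + (6 * T ^ 2) * (energy μ f ω).toReal ^ 2 +
        (-4 * T ^ 3) * (energy μ f ω).toReal ^ 1) P := j2.add (i1.const_mul _)
    rw [integral_add j1 (integrable_const _), integral_add j2 (i1.const_mul _),
      integral_add j3 (i2.const_mul _),
      integral_add i4 (i3.const_mul _), integral_const_mul, integral_const_mul,
      integral_const_mul, m1, m2, m3, m4]
    simp
    ring
  refine ⟨?_, ?_, ?_⟩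
  · rw [variance_congr hae, variance_of_integral_eq_zero
      (hE.ennreal_toReal.sub_const _).aemeasurable, e2]
    simp only [pow_one] at i1 m1
    rw [integral_sub i1 (integrable_const _), m1]
    simp
  · rw [← e2]
    exact integral_congr_ae (hae.mono fun ω hω => congrArg (· ^ 2) hω)
  · rw [← e4]
    exact integral_congr_ae (hae.mono fun ω hω => congrArg (· ^ 4) hω)

end CenteredEnergy

theorem RotationInvariant.isReproducingKernel_legendreP {μ : Measure S2} [IsFiniteMeasure μ]
    (hμ : RotationInvariant μ) (h0 : μ.real Set.univ ≠ 0) (l : ℕ) :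
    IsReproducingKernel μ (fun x y => (legendreP l).eval (inner ℝ (x : E3) (y : E3)))
      (μ.real Set.univ / (2 * l + 1)) where
  continuous := by fun_prop
  self x := by
    rw [real_inner_self_eq_norm_sq, mem_sphere_zero_iff_norm.mp x.2, one_pow, legendreP_eval_one]
  comm x y := by rw [real_inner_comm]
  integral_mul x z := by
    have h1 : zonal μ 1 = μ.real Set.univ := by simp [zonal_apply]
    rw [← h1] at h0 ⊢
    exact hμ.integral_legendreP_mul_legendreP h0 l x z
  nonneg := by positivity

/-- for the centered isotropic Gaussian field `f_l` with covariance
`P_l(⟨x,y⟩)`, the fourth cumulant of `h_{l;2} = ∫_{S²} H₂(f_l) dx` equals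
`48(4π)⁴/(2l+1)³`, hence `cum₄/Var² = 12/(2l+1) → 0`. -/
theorem fourth_cumulant_h2
    (μ : Measure S2) [IsFiniteMeasure μ]
    (hμ : μ Set.univ = ENNReal.ofReal (4 * Real.pi))
    (hrot : ∀ R : E3 ≃ₗᵢ[ℝ] E3,
      Measure.map
        (fun y : S2 => (⟨R y, by
          simp only [mem_sphere_zero_iff_norm, R.norm_map]
          exact mem_sphere_zero_iff_norm.mp y.2⟩ : S2)) μ = μ)
    {Ω : Type*} [MeasureSpace Ω] [IsProbabilityMeasure (volume : Measure Ω)]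
    (l : ℕ) (f : S2 → Ω → ℝ)
    (hmeas : Measurable (Function.uncurry f))
    (hGauss : ∀ (n : ℕ) (c : Fin n → ℝ) (x : Fin n → S2),
      Measure.map (fun ω => ∑ i, c i * f (x i) ω) volume =
        gaussianReal 0 (Real.toNNReal (∑ i, ∑ j, c i * c j *
          (legendreP l).eval (@inner ℝ E3 _ (x i : E3) (x j : E3)))))
    (h : Ω → ℝ) (hdef : h = fun ω => ∫ x, ((f x ω) ^ 2 - 1) ∂μ) :
    (∫ ω, (h ω) ^ 4) - 3 * (∫ ω, (h ω) ^ 2) ^ 2 =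
        48 * (4 * Real.pi) ^ 4 / (2 * (l : ℝ) + 1) ^ 3 ∧
    ((∫ ω, (h ω) ^ 4) - 3 * (∫ ω, (h ω) ^ 2) ^ 2) / (variance h volume) ^ 2 =
        12 / (2 * (l : ℝ) + 1) ∧
    Tendsto (fun m : ℕ => (12 : ℝ) / (2 * (m : ℝ) + 1)) atTop (nhds 0) := by
  have hT : μ.real Set.univ = 4 * π := by
    rw [measureReal_def, hμ, ENNReal.toReal_ofReal (by positivity)]
  have hK := (rotationInvariant_of_map_eq _ hrot).isReproducingKernel_legendreP
    (hT ▸ by positivity) l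
  have hf : IsUnitGaussianFamily volume f
      (fun x y => (legendreP l).eval (inner ℝ (x : E3) (y : E3))) :=
    ⟨fun x => hmeas.comp measurable_prodMk_left, hK.self, hK.comm, hGauss⟩
  obtain ⟨hvar, h2, h4⟩ := hf.moments_centered_energy hK hmeas
  rw [hT] at hvar h2 h4
  have hl : (0 : ℝ) < 2 * l + 1 := by positivity
  have hcum : (∫ ω, (h ω) ^ 4) - 3 * (∫ ω, (h ω) ^ 2) ^ 2 =
      48 * (4 * π) ^ 4 / (2 * (l : ℝ) + 1) ^ 3 := by
    rw [hdef, h2, h4]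
    field_simp
    ring
  refine ⟨hcum, ?_, ?_⟩
  · rw [hcum, hdef, hvar]
    field_simp
    ring
  · refine tendsto_const_nhds.div_atTop (tendsto_atTop_add_const_right _ _ ?_)
    exact tendsto_natCast_atTop_atTop.const_mul_atTop two_pos
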